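/- Let E₁ ⊂ E₂ ⊂ … ⊂ E_i ⊂ E_{i+1} ⊂ … ⊂ Ω be an increasing sequence of sets. Then C̃_{BV^{p(·)}}(⋃_{i=1}^∞ E_i) = lim_{i→∞} C̃_{BV^{p(·)}}(E_i). -/

import Mathlib

open MeasureTheory Filter Topology ENNReal Set

noncomputable section

/-- Euclidean space `ℝⁿ`. -/
abbrev Eu (n : ℕ) : Type := EuclideanSpace ℝ (Fin n)

/-- The modular `ρ_{p(·)}(u) = ∫_Ω |u|^{p(x)} dx`. -/
def vModular {n : ℕ} (p : Eu n → ℝ) (Ω : Set (Eu n)) (u : Eu n → ℝ) : ℝ≥0∞ :=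
  ∫⁻ x in Ω, ENNReal.ofReal (|u x| ^ p x)

/-- The gradient modular `∫_Ω |∇u|^{p(x)} dx` (for a.e. differentiable `u`,
`fderiv` is the gradient). -/
def gradModular {n : ℕ} (p : Eu n → ℝ) (Ω : Set (Eu n)) (u : Eu n → ℝ) : ℝ≥0∞ :=
  ∫⁻ x in Ω, ENNReal.ofReal (‖fderiv ℝ u x‖ ^ p x)

/-- Membership in the variable exponent Lebesgue space `L^{p(·)}(Ω)`. -/
def MemLpVar {n : ℕ} (p : Eu n → ℝ) (Ω : Set (Eu n)) (u : Eu n → ℝ) : Prop :=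
  Measurable u ∧ ∃ l : ℝ, 0 < l ∧ vModular p Ω (fun x => u x / l) < ⊤

/-- The Luxemburg norm on `L^{p(·)}(Ω)`. -/
def luxNorm {n : ℕ} (p : Eu n → ℝ) (Ω : Set (Eu n)) (u : Eu n → ℝ) : ℝ :=
  sInf {l : ℝ | 0 < l ∧ vModular p Ω (fun x => u x / l) ≤ 1}

/-- Convergence `v i → u` in `L^{p(·)}(Ω)` (Luxemburg norm convergence). -/
def LpTendsto {n : ℕ} (p : Eu n → ℝ) (Ω : Set (Eu n)) (v : ℕ → Eu n → ℝ)
    (u : Eu n → ℝ) : Prop :=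
  Tendsto (fun i => luxNorm p Ω (fun x => v i x - u x)) atTop (𝓝 0)

/-- `u` is locally Lipschitz on `Ω`. -/
def LocLipOn {n : ℕ} (Ω : Set (Eu n)) (u : Eu n → ℝ) : Prop :=
  ∀ x ∈ Ω, ∃ K : NNReal, ∃ t ∈ 𝓝[Ω] x, LipschitzOnWith K u t

/-- The relaxed mixed pseudo-modular `ρ̃_{BV^{p(·)}(Ω)}(u)`: the infimum of
`liminf_i ∫_Ω |∇u_i|^{p(x)} dx` over all sequences of locally Lipschitz functions
in `L^{p(·)}(Ω)` converging to `u` in `L^{p(·)}(Ω)`. -/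
def bvModular {n : ℕ} (p : Eu n → ℝ) (Ω : Set (Eu n)) (u : Eu n → ℝ) : ℝ≥0∞ :=
  ⨅ (v : ℕ → Eu n → ℝ)
    (_ : (∀ i, LocLipOn Ω (v i) ∧ MemLpVar p Ω (v i)) ∧ LpTendsto p Ω v u),
    Filter.liminf (fun i => gradModular p Ω (v i)) atTop

/-- Membership in the mixed space `B̃V^{p(·)}(Ω)`. -/
def MemBVt {n : ℕ} (p : Eu n → ℝ) (Ω : Set (Eu n)) (u : Eu n → ℝ) : Prop :=
  MemLpVar p Ω u ∧ bvModular p Ω u < ⊤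

/-- The norm `‖u‖_{B̃V^{p(·)}}`. -/
def bvNorm {n : ℕ} (p : Eu n → ℝ) (Ω : Set (Eu n)) (u : Eu n → ℝ) : ℝ :=
  luxNorm p Ω u + sInf {l : ℝ | 0 < l ∧ bvModular p Ω (fun x => u x / l) ≤ 1}

/-- The admissible class `Ã(E)` for the mixed capacity. -/
def admissibleBV {n : ℕ} (p : Eu n → ℝ) (Ω E : Set (Eu n)) : Set (Eu n → ℝ) :=
  {u | MemBVt p Ω u ∧ (∀ x ∈ Ω, 0 ≤ u x ∧ u x ≤ 1) ∧
       ∃ U : Set (Eu n), IsOpen U ∧ E ⊆ U ∧ ∀ x ∈ U ∩ Ω, u x = 1}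

/-- The mixed BV-Sobolev capacity `C̃_{BV^{p(·)}}(E)` (with `inf ∅ = ∞`). -/
def bvCapacity {n : ℕ} (p : Eu n → ℝ) (Ω E : Set (Eu n)) : ℝ≥0∞ :=
  ⨅ (u : Eu n → ℝ) (_ : u ∈ admissibleBV p Ω E), vModular p Ω u + bvModular p Ω u

/-- Divergence of a vector field. -/
def divg {n : ℕ} (φ : Eu n → Eu n) (x : Eu n) : ℝ :=
  ∑ i, fderiv ℝ φ x (EuclideanSpace.single i 1) i

/-- Total variation `‖Du‖(U)` on an open set `U`, via the defining supremum over
`C¹` vector fields compactly supported in `U` with `|φ| ≤ 1`. -/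
def totVarOpen {n : ℕ} (U : Set (Eu n)) (u : Eu n → ℝ) : ℝ≥0∞ :=
  ⨆ (φ : Eu n → Eu n)
    (_ : ContDiff ℝ 1 φ ∧ HasCompactSupport φ ∧ tsupport φ ⊆ U ∧ ∀ x, ‖φ x‖ ≤ 1),
    ENNReal.ofReal (∫ x in U, u x * divg φ x)

/-- Total variation `‖Du‖(A)` of a set `A ⊆ Ω`, extended from open sets. -/
def totVarIn {n : ℕ} (Ω A : Set (Eu n)) (u : Eu n → ℝ) : ℝ≥0∞ :=
  ⨅ (U : Set (Eu n)) (_ : IsOpen U ∧ A ⊆ U ∧ U ⊆ Ω), totVarOpen U u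

/-- `g` is the weak (distributional) gradient of `u` on `Ω`. -/
def IsWeakGrad {n : ℕ} (Ω : Set (Eu n)) (u : Eu n → ℝ) (g : Eu n → Eu n) : Prop :=
  ∀ φ : Eu n → ℝ, ContDiff ℝ 1 φ → HasCompactSupport φ → tsupport φ ⊆ Ω →
    ∀ i : Fin n,
      (∫ x in Ω, u x * (fderiv ℝ φ x (EuclideanSpace.single i 1))) =
        - ∫ x in Ω, g x i * φ x

/-- The Harjulehto–Hästö–Latvala mixed pseudo-modular
`ρ_{BV^{p(·)}(F)}(u) = ‖Du‖(F ∩ Y) + ∫_{F∖Y} |∇u|^{p(x)} dx`, where `Y = {p = 1}`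
and `g` is the weak gradient of `u` on the Sobolev part. -/
def hhlModular {n : ℕ} (p : Eu n → ℝ) (Ω F : Set (Eu n)) (u : Eu n → ℝ)
    (g : Eu n → Eu n) : ℝ≥0∞ :=
  totVarIn Ω (F ∩ {x | p x = 1}) u +
    ∫⁻ x in F \ {x | p x = 1}, ENNReal.ofReal (‖g x‖ ^ p x)

/-- The HHL mixed pseudo-modular for (smooth) functions whose gradient is `fderiv`. -/
def hhlModularSmooth {n : ℕ} (p : Eu n → ℝ) (Ω F : Set (Eu n)) (v : Eu n → ℝ) : ℝ≥0∞ :=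
  totVarIn Ω (F ∩ {x | p x = 1}) v +
    ∫⁻ x in F \ {x | p x = 1}, ENNReal.ofReal (‖fderiv ℝ v x‖ ^ p x)

/-- Membership in the HHL space `BV^{p(·)}(Ω)`: `u ∈ L^{p(·)}(Ω)` and
`inf{λ > 0 : ρ_{BV^{p(·)}(Ω)}(u/λ) ≤ 1} < ∞`. -/
def MemBVp {n : ℕ} (p : Eu n → ℝ) (Ω : Set (Eu n)) (u : Eu n → ℝ) : Prop :=
  MemLpVar p Ω u ∧
    ∃ g : Eu n → Eu n, IsWeakGrad (Ω \ {x | p x = 1}) u g ∧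
      ∃ l : ℝ, 0 < l ∧
        hhlModular p Ω Ω (fun x => u x / l) (fun x => l⁻¹ • g x) ≤ 1

/-- Mollification `u_δ = φ_δ ∗ u` (with `u` extended by zero outside `Ω`),
where `φ_δ(z) = δ^{-n} φ(z/δ)`. -/
def mollify {n : ℕ} (Ω : Set (Eu n)) (u : Eu n → ℝ) (φ : Eu n → ℝ) (δ : ℝ)
    (x : Eu n) : ℝ :=
  ∫ y in Ω, (δ ^ n)⁻¹ * φ (δ⁻¹ • (x - y)) * u y

/-- `p` is (locally) log-Hölder continuous on `Ω` with constant `c`. -/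
def LogHolderOn {n : ℕ} (c : ℝ) (Ω : Set (Eu n)) (p : Eu n → ℝ) : Prop :=
  ∀ x ∈ Ω, ∀ y ∈ Ω, |p x - p y| ≤ c / Real.log (Real.exp 1 + 1 / dist x y)

/-- `p` is globally log-Hölder continuous on `ℝⁿ` with constant `c`. -/
def LogHolderGlobal {n : ℕ} (c : ℝ) (p : Eu n → ℝ) : Prop :=
  LogHolderOn c Set.univ p ∧
    ∃ pinf : ℝ, 1 ≤ pinf ∧ ∀ x, |p x - pinf| ≤ c / Real.log (Real.exp 1 + ‖x‖)

/-- The variable exponent Sobolev capacity `C_{p(·)}(E)`: infimum of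
`∫ |u|^{p(x)} + |∇u|^{p(x)} dx` over `u ∈ W^{1,p(·)}(ℝⁿ)` with `u ≥ 1` on an
open set containing `E`. -/
def sobolevCapacity {n : ℕ} (p : Eu n → ℝ) (E : Set (Eu n)) : ℝ≥0∞ :=
  ⨅ (u : Eu n → ℝ) (g : Eu n → Eu n)
    (_ : MemLpVar p Set.univ u ∧ IsWeakGrad Set.univ u g ∧
         MemLpVar p Set.univ (fun x => ‖g x‖) ∧
         ∃ U : Set (Eu n), IsOpen U ∧ E ⊆ U ∧ ∀ x ∈ U, 1 ≤ u x),
    vModular p Set.univ u + ∫⁻ x, ENNReal.ofReal (‖g x‖ ^ p x)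

/-! ### Elementary estimates for the modular -/

lemma vMod_mul_ge {n : ℕ} {p : Eu n → ℝ} {Ω : Set (Eu n)} (hΩ : IsOpen Ω) {M : ℝ}
    (hp : ∀ x ∈ Ω, 1 ≤ p x ∧ p x ≤ M) {c : ℝ} (hc : 1 ≤ c) (f : Eu n → ℝ) :
    vModular p Ω (fun x => c * f x) ≤ ENNReal.ofReal (c ^ M) * vModular p Ω f := by
  unfold vModular
  rw [← lintegral_const_mul' _ _ ENNReal.ofReal_ne_top]
  refine setLIntegral_mono' hΩ.measurableSet fun x hx => ?_
  rw [← ENNReal.ofReal_mul (by positivity)]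
  apply ENNReal.ofReal_le_ofReal
  rw [abs_mul, abs_of_nonneg (by linarith), Real.mul_rpow (by linarith) (abs_nonneg _)]
  gcongr
  exact (hp x hx).2

lemma vMod_mul_le {n : ℕ} {p : Eu n → ℝ} {Ω : Set (Eu n)} (hΩ : IsOpen Ω) {M : ℝ}
    (hp : ∀ x ∈ Ω, 1 ≤ p x ∧ p x ≤ M) {c : ℝ} (hc0 : 0 < c) (hc : c ≤ 1) (f : Eu n → ℝ) :
    vModular p Ω (fun x => c * f x) ≤ ENNReal.ofReal c * vModular p Ω f := by
  unfold vModular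
  rw [← lintegral_const_mul' _ _ ENNReal.ofReal_ne_top]
  refine setLIntegral_mono' hΩ.measurableSet fun x hx => ?_
  rw [← ENNReal.ofReal_mul (by positivity)]
  apply ENNReal.ofReal_le_ofReal
  rw [abs_mul, abs_of_nonneg hc0.le, Real.mul_rpow hc0.le (abs_nonneg _)]
  gcongr
  calc c ^ p x ≤ c ^ (1 : ℝ) := Real.rpow_le_rpow_of_exponent_ge hc0 hc (hp x hx).1
    _ = c := Real.rpow_one c

lemma vMod_mono {n : ℕ} {p : Eu n → ℝ} {Ω : Set (Eu n)} (hΩ : IsOpen Ω) {M : ℝ}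
    (hp : ∀ x ∈ Ω, 1 ≤ p x ∧ p x ≤ M) {f g : Eu n → ℝ} (h : ∀ x ∈ Ω, |f x| ≤ |g x|) :
    vModular p Ω f ≤ vModular p Ω g := by
  refine setLIntegral_mono' hΩ.measurableSet fun x hx => ?_
  apply ENNReal.ofReal_le_ofReal
  exact Real.rpow_le_rpow (abs_nonneg _) (h x hx) (by linarith [(hp x hx).1])

lemma vMod_meas {n : ℕ} {p : Eu n → ℝ} (hpm : Measurable p) {f : Eu n → ℝ} (hf : Measurable f) :
    Measurable (fun x => ENNReal.ofReal (|f x| ^ p x)) := by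
  have : Measurable (fun x => |f x|) := by simpa [Real.norm_eq_abs] using hf.norm
  exact (this.pow hpm).ennreal_ofReal

lemma vMod_add_le {n : ℕ} {p : Eu n → ℝ} {Ω : Set (Eu n)} (hΩ : IsOpen Ω) (hpm : Measurable p)
    {M : ℝ} (hp : ∀ x ∈ Ω, 1 ≤ p x ∧ p x ≤ M) {f g h : Eu n → ℝ} (hf : Measurable f)
    (hh : ∀ x ∈ Ω, |h x| ≤ |f x| + |g x|) :
    vModular p Ω h ≤ ENNReal.ofReal (2 ^ M) * (vModular p Ω f + vModular p Ω g) := by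
  unfold vModular
  rw [← lintegral_add_left (vMod_meas hpm hf), ← lintegral_const_mul' _ _ ENNReal.ofReal_ne_top]
  refine setLIntegral_mono' hΩ.measurableSet fun x hx => ?_
  rw [← ENNReal.ofReal_add (by positivity) (by positivity), ← ENNReal.ofReal_mul (by positivity)]
  apply ENNReal.ofReal_le_ofReal
  have hp0 : 0 ≤ p x := by linarith [(hp x hx).1]
  have h1 : |h x| ≤ 2 * max |f x| |g x| := by
    have := hh x hx
    linarith [le_max_left |f x| |g x|, le_max_right |f x| |g x|]
  have hm : 0 ≤ max |f x| |g x| := le_max_of_le_left (abs_nonneg _)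
  calc |h x| ^ p x ≤ (2 * max |f x| |g x|) ^ p x := Real.rpow_le_rpow (abs_nonneg _) h1 hp0
    _ = 2 ^ p x * (max |f x| |g x|) ^ p x := Real.mul_rpow (by norm_num) hm
    _ ≤ 2 ^ M * (|f x| ^ p x + |g x| ^ p x) := by
      have h2 : (max |f x| |g x|) ^ p x ≤ |f x| ^ p x + |g x| ^ p x := by
        have a := Real.rpow_nonneg (abs_nonneg (f x)) (p x)
        have b := Real.rpow_nonneg (abs_nonneg (g x)) (p x)
        rcases max_cases |f x| |g x| with ⟨e, _⟩ | ⟨e, _⟩ <;> rw [e] <;> linarith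
      have h3 : (2 : ℝ) ^ p x ≤ 2 ^ M :=
        Real.rpow_le_rpow_of_exponent_le (by norm_num) (hp x hx).2
      exact mul_le_mul h3 h2 (Real.rpow_nonneg hm _) (by positivity)

lemma memLpVar_iff {n : ℕ} {p : Eu n → ℝ} {Ω : Set (Eu n)} (hΩ : IsOpen Ω) {M : ℝ}
    (hp : ∀ x ∈ Ω, 1 ≤ p x ∧ p x ≤ M) {f : Eu n → ℝ} :
    MemLpVar p Ω f ↔ Measurable f ∧ vModular p Ω f < ⊤ := by
  constructor
  · rintro ⟨hm, l, hl, hfin⟩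
    refine ⟨hm, ?_⟩
    have h1 : vModular p Ω f ≤ vModular p Ω (fun x => (max l 1) * (f x / l)) := by
      refine vMod_mono hΩ hp fun x _ => ?_
      have : f x = l * (f x / l) := by field_simp
      rw [abs_mul, abs_of_pos (lt_max_of_lt_left hl)]
      calc |f x| = l * |f x / l| := by rw [abs_div, abs_of_pos hl]; field_simp
        _ ≤ _ := by gcongr; exact le_max_left _ _
    refine h1.trans_lt ((vMod_mul_ge hΩ hp (le_max_right _ _) _).trans_lt ?_)
    exact ENNReal.mul_lt_top ENNReal.ofReal_lt_top hfin
  · rintro ⟨hm, hfin⟩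
    exact ⟨hm, 1, one_pos, by simpa using hfin⟩

/-- Small Luxemburg norm implies small modular. -/
lemma vMod_le_of_lux_lt {n : ℕ} {p : Eu n → ℝ} {Ω : Set (Eu n)} (hΩ : IsOpen Ω) {M : ℝ}
    (hp : ∀ x ∈ Ω, 1 ≤ p x ∧ p x ≤ M) {f : Eu n → ℝ} (hf : vModular p Ω f < ⊤) {ε : ℝ}
    (hε1 : ε ≤ 1) (h : luxNorm p Ω f < ε) : vModular p Ω f ≤ ENNReal.ofReal ε := by
  have hne : {l : ℝ | 0 < l ∧ vModular p Ω (fun x => f x / l) ≤ 1}.Nonempty := by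
    set L : ℝ := max 1 (vModular p Ω f).toReal
    have hL : 0 < L := lt_max_of_lt_left one_pos
    refine ⟨L, hL, ?_⟩
    have h1 := vMod_mul_le hΩ hp (inv_pos.2 hL) (inv_le_one_of_one_le₀ (le_max_left _ _)) f
    have h2 : (fun x => f x / L) = fun x => L⁻¹ * f x := by
      funext x; rw [div_eq_inv_mul]
    rw [h2]
    refine h1.trans ?_
    have h3 : vModular p Ω f ≤ ENNReal.ofReal L := by
      rw [← ENNReal.ofReal_toReal hf.ne]
      exact ENNReal.ofReal_le_ofReal (le_max_right _ _)
    calc _ ≤ ENNReal.ofReal L⁻¹ * ENNReal.ofReal L := by gcongr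
      _ = 1 := by
        rw [← ENNReal.ofReal_mul (inv_pos.2 hL).le, inv_mul_cancel₀ hL.ne', ENNReal.ofReal_one]
  obtain ⟨l, ⟨hl, hm⟩, hlε⟩ := exists_lt_of_csInf_lt hne h
  have h1 := vMod_mul_le hΩ hp hl (hlε.le.trans hε1) (fun x => f x / l)
  have h2 : (fun x => l * (f x / l)) = f := by
    funext x; field_simp
  rw [h2] at h1
  calc _ ≤ _ := h1
    _ ≤ ENNReal.ofReal l * 1 := by gcongr
    _ ≤ ENNReal.ofReal ε := by rw [mul_one]; exact ENNReal.ofReal_le_ofReal hlε.le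

/-- Small modular implies small Luxemburg norm. -/
lemma lux_le_of_vMod_le {n : ℕ} {p : Eu n → ℝ} {Ω : Set (Eu n)} (hΩ : IsOpen Ω) {M : ℝ}
    (hp : ∀ x ∈ Ω, 1 ≤ p x ∧ p x ≤ M) {f : Eu n → ℝ} {δ : ℝ} (hδ : 0 < δ) (hδ1 : δ ≤ 1)
    (h : vModular p Ω f ≤ ENNReal.ofReal (δ ^ M)) : luxNorm p Ω f ≤ δ := by
  refine csInf_le ⟨0, fun l hl => hl.1.le⟩ ⟨hδ, ?_⟩
  have h1 := vMod_mul_ge hΩ hp ((one_le_inv₀ hδ).2 hδ1) f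
  have h2 : (fun x => f x / δ) = fun x => δ⁻¹ * f x := by
    funext x; rw [div_eq_inv_mul]
  rw [h2]
  calc _ ≤ _ := h1
    _ ≤ ENNReal.ofReal (δ⁻¹ ^ M) * ENNReal.ofReal (δ ^ M) := by gcongr
    _ = 1 := by
      rw [← ENNReal.ofReal_mul (by positivity), ← Real.mul_rpow (by positivity) hδ.le,
        inv_mul_cancel₀ hδ.ne', Real.one_rpow, ENNReal.ofReal_one]

lemma lux_nonneg {n : ℕ} (p : Eu n → ℝ) (Ω : Set (Eu n)) (f : Eu n → ℝ) :
    0 ≤ luxNorm p Ω f := Real.sInf_nonneg fun _ hl => hl.1.le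

/-- Approximability of `u` by locally Lipschitz functions with gradient modular at most `c`. -/
def AppBV {n : ℕ} (p : Eu n → ℝ) (Ω : Set (Eu n)) (u : Eu n → ℝ) (c : ℝ≥0∞) : Prop :=
  ∀ ε : ℝ≥0∞, 0 < ε → ∃ w : Eu n → ℝ, LocLipOn Ω w ∧ Measurable w ∧ vModular p Ω w < ⊤ ∧
    vModular p Ω (fun x => w x - u x) < ε ∧ gradModular p Ω w ≤ c

lemma vMod_sub_lt_top {n : ℕ} {p : Eu n → ℝ} {Ω : Set (Eu n)} (hΩ : IsOpen Ω)
    (hpm : Measurable p) {M : ℝ} (hp : ∀ x ∈ Ω, 1 ≤ p x ∧ p x ≤ M) {f g : Eu n → ℝ}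
    (hf : Measurable f) (hf' : vModular p Ω f < ⊤) (hg' : vModular p Ω g < ⊤) :
    vModular p Ω (fun x => f x - g x) < ⊤ :=
  (vMod_add_le hΩ hpm hp hf (fun x _ => abs_sub (f x) (g x))).trans_lt
    (ENNReal.mul_lt_top ENNReal.ofReal_lt_top (ENNReal.add_lt_top.2 ⟨hf', hg'⟩))

lemma appBV_of_lt {n : ℕ} {p : Eu n → ℝ} {Ω : Set (Eu n)} (hΩ : IsOpen Ω)
    (hpm : Measurable p) {M : ℝ} (hp : ∀ x ∈ Ω, 1 ≤ p x ∧ p x ≤ M) {u : Eu n → ℝ}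
    (hu : MemLpVar p Ω u) {c : ℝ≥0∞} (h : bvModular p Ω u < c) : AppBV p Ω u c := by
  intro ε hε
  rw [memLpVar_iff hΩ hp] at hu
  simp only [bvModular, iInf_lt_iff] at h
  obtain ⟨v, ⟨hv, hvu⟩, hlim⟩ := h
  have hfreq := frequently_lt_of_liminf_lt (by isBoundedDefault) hlim
  obtain ⟨r, hr0, hr⟩ : ∃ r : ℝ, 0 < r ∧ ENNReal.ofReal r < ε := by
    obtain ⟨r, hr0, hr⟩ := ENNReal.lt_iff_exists_nnreal_btwn.1 hε
    exact ⟨r, by exact_mod_cast hr0, by simpa using hr⟩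
  have hev := (tendsto_order.1 hvu).2 (min r 1) (lt_min hr0 one_pos)
  obtain ⟨i, hi1, hi2⟩ := (hfreq.and_eventually hev).exists
  have hvi := (memLpVar_iff hΩ hp).1 (hv i).2
  refine ⟨v i, (hv i).1, hvi.1, hvi.2, ?_, hi1.le⟩
  refine (vMod_le_of_lux_lt hΩ hp (vMod_sub_lt_top hΩ hpm hp hvi.1 hvi.2 hu.2)
    (min_le_right _ _) hi2).trans_lt (lt_of_le_of_lt ?_ hr)
  exact ENNReal.ofReal_le_ofReal (min_le_left _ _)

lemma lpTendsto_of {n : ℕ} {p : Eu n → ℝ} {Ω : Set (Eu n)} (hΩ : IsOpen Ω) {M : ℝ}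
    (hp : ∀ x ∈ Ω, 1 ≤ p x ∧ p x ≤ M) {u : Eu n → ℝ} {v : ℕ → Eu n → ℝ}
    (h : Tendsto (fun i => vModular p Ω (fun x => v i x - u x)) atTop (𝓝 0)) :
    LpTendsto p Ω v u := by
  refine tendsto_order.2 ⟨fun a ha => Eventually.of_forall fun i => ha.trans_le (lux_nonneg _ _ _),
    fun a ha => ?_⟩
  have hδ : 0 < min (a / 2) 1 := lt_min (by linarith) one_pos
  have h2 : (0 : ℝ≥0∞) < ENNReal.ofReal ((min (a / 2) 1) ^ M) :=
    ENNReal.ofReal_pos.2 (Real.rpow_pos_of_pos hδ _)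
  filter_upwards [(tendsto_order.1 h).2 _ h2] with i hi
  have := lux_le_of_vMod_le hΩ hp hδ (min_le_right _ _) hi.le
  linarith [min_le_left (a / 2) 1]

/-- A real sequence tending to zero in `ℝ≥0∞`, used as accuracy. -/
lemma tendsto_inv_succ : Tendsto (fun k : ℕ => ((k : ℝ≥0∞) + 1)⁻¹) atTop (𝓝 0) := by
  have := (tendsto_add_atTop_iff_nat 1).2 ENNReal.tendsto_inv_nat_nhds_zero
  simpa using this

lemma bv_le_of_app {n : ℕ} {p : Eu n → ℝ} {Ω : Set (Eu n)} (hΩ : IsOpen Ω) {M : ℝ}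
    (hp : ∀ x ∈ Ω, 1 ≤ p x ∧ p x ≤ M) {u : Eu n → ℝ} {c : ℝ≥0∞} (h : AppBV p Ω u c) :
    bvModular p Ω u ≤ c := by
  choose w hw1 hw2 hw3 hw4 hw5 using fun k : ℕ => h (((k : ℝ≥0∞) + 1)⁻¹) (by simp)
  refine (iInf₂_le w ⟨fun i => ⟨hw1 i, (memLpVar_iff hΩ hp).2 ⟨hw2 i, hw3 i⟩⟩,
    lpTendsto_of hΩ hp ?_⟩).trans ?_
  · exact liminf_le_of_frequently_le' (Frequently.of_forall hw5)
  · exact tendsto_of_tendsto_of_tendsto_of_le_of_le tendsto_const_nhds tendsto_inv_succ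
      (fun _ => bot_le) (fun i => (hw4 i).le)

lemma liminf_add_liminf_le (a b : ℕ → ℝ≥0∞) :
    liminf a atTop + liminf b atTop ≤ liminf (fun i => a i + b i) atTop := by
  simp only [liminf_eq_iSup_iInf_of_nat]
  rw [ENNReal.iSup_add_iSup_of_monotone]
  · refine iSup_mono fun k => le_iInf₂ fun i hi => add_le_add (iInf₂_le i hi) (iInf₂_le i hi)
  · exact fun i j hij => le_iInf₂ fun k hk => iInf₂_le k (hij.trans hk)
  · exact fun i j hij => le_iInf₂ fun k hk => iInf₂_le k (hij.trans hk)

/-! ### Locally Lipschitz functions -/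

lemma LocLipOn.max' {n : ℕ} {Ω : Set (Eu n)} {u v : Eu n → ℝ} (hu : LocLipOn Ω u)
    (hv : LocLipOn Ω v) : LocLipOn Ω (fun x => max (u x) (v x)) := by
  intro x hx
  obtain ⟨K, t, ht, h1⟩ := hu x hx
  obtain ⟨L, s, hs, h2⟩ := hv x hx
  refine ⟨max K L, t ∩ s, inter_mem ht hs, ?_⟩
  have a := lipschitzOnWith_iff_restrict.1 (h1.mono (inter_subset_left (t := s)))
  have b := lipschitzOnWith_iff_restrict.1 (h2.mono (inter_subset_right (s := t)))
  exact lipschitzOnWith_iff_restrict.2 (a.max b)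

lemma LocLipOn.min' {n : ℕ} {Ω : Set (Eu n)} {u v : Eu n → ℝ} (hu : LocLipOn Ω u)
    (hv : LocLipOn Ω v) : LocLipOn Ω (fun x => min (u x) (v x)) := by
  intro x hx
  obtain ⟨K, t, ht, h1⟩ := hu x hx
  obtain ⟨L, s, hs, h2⟩ := hv x hx
  refine ⟨max K L, t ∩ s, inter_mem ht hs, ?_⟩
  have a := lipschitzOnWith_iff_restrict.1 (h1.mono (inter_subset_left (t := s)))
  have b := lipschitzOnWith_iff_restrict.1 (h2.mono (inter_subset_right (s := t)))
  exact lipschitzOnWith_iff_restrict.2 (a.min b)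

lemma LocLipOn.ae_diff {n : ℕ} {Ω : Set (Eu n)} (hΩ : IsOpen Ω) {u : Eu n → ℝ}
    (hu : LocLipOn Ω u) : ∀ᵐ x ∂(volume.restrict Ω), DifferentiableAt ℝ u x := by
  rw [ae_restrict_iff' hΩ.measurableSet]
  change volume {x | ¬ (x ∈ Ω → DifferentiableAt ℝ u x)} = 0
  refine measure_null_of_locally_null _ fun x hx => ?_
  simp only [mem_ofPred_eq, Classical.not_imp] at hx
  obtain ⟨K, t, ht, h1⟩ := hu x hx.1
  rw [hΩ.nhdsWithin_eq hx.1] at ht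
  obtain ⟨s, hst, hso, hxs⟩ := mem_nhds_iff.1 ht
  have h2 := (h1.mono hst).ae_differentiableWithinAt_of_mem (μ := (volume : Measure (Eu n)))
  refine ⟨s ∩ {x | ¬ (x ∈ Ω → DifferentiableAt ℝ u x)},
    inter_mem (mem_nhdsWithin_of_mem_nhds (hso.mem_nhds hxs)) self_mem_nhdsWithin, ?_⟩
  refine measure_mono_null ?_ h2
  rintro y ⟨hys, hy⟩ hy2
  exact hy fun _ => (hy2 hys).differentiableAt (hso.mem_nhds hys)

lemma fderiv_max_min {n : ℕ} {u v : Eu n → ℝ} {x : Eu n} (hu : DifferentiableAt ℝ u x)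
    (hv : DifferentiableAt ℝ v x) (hM : DifferentiableAt ℝ (fun x => max (u x) (v x)) x) :
    (fderiv ℝ (fun x => max (u x) (v x)) x = fderiv ℝ u x ∧
      fderiv ℝ (fun x => min (u x) (v x)) x = fderiv ℝ v x) ∨
    (fderiv ℝ (fun x => max (u x) (v x)) x = fderiv ℝ v x ∧
      fderiv ℝ (fun x => min (u x) (v x)) x = fderiv ℝ u x) := by
  have hmin : (fun x => min (u x) (v x)) = fun x => u x + v x - max (u x) (v x) := by
    funext y; rw [← min_add_max (u y) (v y)]; ring
  have hminD : fderiv ℝ (fun x => min (u x) (v x)) x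
      = fderiv ℝ u x + fderiv ℝ v x - fderiv ℝ (fun x => max (u x) (v x)) x := by
    rw [hmin, fderiv_fun_sub (hu.fun_add hv) hM, fderiv_fun_add hu hv]
  have key : fderiv ℝ (fun x => max (u x) (v x)) x = fderiv ℝ u x ∨
      fderiv ℝ (fun x => max (u x) (v x)) x = fderiv ℝ v x := by
    rcases lt_trichotomy (u x) (v x) with h | h | h
    · right
      apply Filter.EventuallyEq.fderiv_eq
      filter_upwards [hu.continuousAt.eventually_lt hv.continuousAt h] with y hy
      exact max_eq_right hy.le
    · left
      have hmn : IsLocalMin (fun y => max (u y) (v y) - u y) x := by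
        refine Eventually.of_forall fun y => ?_
        simp [h]
      have h0 := hmn.fderiv_eq_zero
      rw [fderiv_fun_sub hM hu] at h0
      exact sub_eq_zero.1 h0
    · left
      apply Filter.EventuallyEq.fderiv_eq
      filter_upwards [hv.continuousAt.eventually_lt hu.continuousAt h] with y hy
      exact max_eq_left hy.le
  rcases key with h | h
  · left; exact ⟨h, by rw [hminD, h]; abel⟩
  · right; exact ⟨h, by rw [hminD, h]; abel⟩

lemma grad_meas {n : ℕ} {p : Eu n → ℝ} (hpm : Measurable p) (f : Eu n → ℝ) :
    Measurable (fun x => ENNReal.ofReal (‖fderiv ℝ f x‖ ^ p x)) :=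
  ((measurable_fderiv ℝ f).norm.pow hpm).ennreal_ofReal

lemma grad_max_min {n : ℕ} {p : Eu n → ℝ} {Ω : Set (Eu n)} (hΩ : IsOpen Ω)
    (hpm : Measurable p) {u v : Eu n → ℝ} (hu : LocLipOn Ω u) (hv : LocLipOn Ω v) :
    gradModular p Ω (fun x => max (u x) (v x)) + gradModular p Ω (fun x => min (u x) (v x))
      = gradModular p Ω u + gradModular p Ω v := by
  unfold gradModular
  rw [← lintegral_add_left (grad_meas hpm _), ← lintegral_add_left (grad_meas hpm _)]
  refine lintegral_congr_ae ?_
  filter_upwards [hu.ae_diff hΩ, hv.ae_diff hΩ, (hu.max' hv).ae_diff hΩ] with x h1 h2 h3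
  rcases fderiv_max_min h1 h2 h3 with ⟨a, b⟩ | ⟨a, b⟩
  · rw [a, b]
  · rw [a, b, add_comm]

lemma vMod_max_min {n : ℕ} {p : Eu n → ℝ} {Ω : Set (Eu n)}
    (hpm : Measurable p) {u v : Eu n → ℝ} (hu : Measurable u) (hv : Measurable v) :
    vModular p Ω (fun x => max (u x) (v x)) + vModular p Ω (fun x => min (u x) (v x))
      = vModular p Ω u + vModular p Ω v := by
  unfold vModular
  rw [← lintegral_add_left (vMod_meas hpm hu), ← lintegral_add_left (vMod_meas hpm (hu.max hv))]
  refine lintegral_congr fun x => ?_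
  beta_reduce
  rcases le_total (u x) (v x) with h | h
  · rw [max_eq_right h, min_eq_left h, add_comm]
  · rw [max_eq_left h, min_eq_right h]

lemma memLp_max {n : ℕ} {p : Eu n → ℝ} {Ω : Set (Eu n)} (hΩ : IsOpen Ω)
    (hpm : Measurable p) {M : ℝ} (hp : ∀ x ∈ Ω, 1 ≤ p x ∧ p x ≤ M) {u v : Eu n → ℝ}
    (hu : MemLpVar p Ω u) (hv : MemLpVar p Ω v) :
    MemLpVar p Ω (fun x => max (u x) (v x)) ∧ MemLpVar p Ω (fun x => min (u x) (v x)) := by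
  rw [memLpVar_iff hΩ hp] at *
  rw [memLpVar_iff hΩ hp]
  have h := vMod_max_min (Ω := Ω) hpm hu.1 hv.1
  have h2 : vModular p Ω u + vModular p Ω v < ⊤ := ENNReal.add_lt_top.2 ⟨hu.2, hv.2⟩
  rw [← h, ENNReal.add_lt_top] at h2
  exact ⟨⟨hu.1.max hv.1, h2.1⟩, ⟨hu.1.min hv.1, h2.2⟩⟩

/-- Strong subadditivity of the relaxed modular. -/
lemma bv_max_min {n : ℕ} {p : Eu n → ℝ} {Ω : Set (Eu n)} (hΩ : IsOpen Ω)
    (hpm : Measurable p) {M : ℝ} (hp : ∀ x ∈ Ω, 1 ≤ p x ∧ p x ≤ M) {u v : Eu n → ℝ}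
    (hu : MemLpVar p Ω u) (hv : MemLpVar p Ω v) :
    bvModular p Ω (fun x => max (u x) (v x)) + bvModular p Ω (fun x => min (u x) (v x))
      ≤ bvModular p Ω u + bvModular p Ω v := by
  refine ENNReal.le_of_forall_pos_le_add fun ε hε hfin => ?_
  rw [ENNReal.add_lt_top] at hfin
  have hε2 : (ε : ℝ≥0∞) / 2 ≠ 0 := by simpa using hε.ne'
  have hA := appBV_of_lt hΩ hpm hp hu (ENNReal.lt_add_right hfin.1.ne hε2)
  have hB := appBV_of_lt hΩ hpm hp hv (ENNReal.lt_add_right hfin.2.ne hε2)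
  choose a ha1 ha2 ha3 ha4 ha5 using fun k : ℕ => hA (((k : ℝ≥0∞) + 1)⁻¹) (by simp)
  choose b hb1 hb2 hb3 hb4 hb5 using fun k : ℕ => hB (((k : ℝ≥0∞) + 1)⁻¹) (by simp)
  have hab := fun i => memLp_max hΩ hpm hp ((memLpVar_iff hΩ hp).2 ⟨ha2 i, ha3 i⟩)
    ((memLpVar_iff hΩ hp).2 ⟨hb2 i, hb3 i⟩)
  have hC : Tendsto (fun k : ℕ => ENNReal.ofReal (2 ^ M) *
      (((k : ℝ≥0∞) + 1)⁻¹ + ((k : ℝ≥0∞) + 1)⁻¹)) atTop (𝓝 0) := by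
    have := ENNReal.Tendsto.const_mul (a := ENNReal.ofReal (2 ^ M))
      (tendsto_inv_succ.add tendsto_inv_succ) (Or.inr ENNReal.ofReal_ne_top)
    simpa using this
  have hle : ∀ h : ℕ → Eu n → ℝ, (∀ i x, |h i x| ≤ |a i x - u x| + |b i x - v x|) →
      Tendsto (fun i => vModular p Ω (h i)) atTop (𝓝 0) := fun h hh =>
    tendsto_of_tendsto_of_tendsto_of_le_of_le tendsto_const_nhds hC (fun _ => bot_le)
      (fun i => (vMod_add_le hΩ hpm hp ((ha2 i).sub hu.1) (fun x _ => hh i x)).trans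
        (by gcongr; exacts [(ha4 i).le, (hb4 i).le]))
  have h1 : bvModular p Ω (fun x => max (u x) (v x)) ≤
      liminf (fun i => gradModular p Ω (fun x => max (a i x) (b i x))) atTop := by
    refine iInf₂_le (fun i x => max (a i x) (b i x)) ⟨fun i => ⟨(ha1 i).max' (hb1 i), (hab i).1⟩,
      lpTendsto_of hΩ hp (hle _ fun i x => ?_)⟩
    refine (abs_max_sub_max_le_max _ _ _ _).trans ?_
    exact max_le_add_of_nonneg (abs_nonneg _) (abs_nonneg _)
  have h2 : bvModular p Ω (fun x => min (u x) (v x)) ≤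
      liminf (fun i => gradModular p Ω (fun x => min (a i x) (b i x))) atTop := by
    refine iInf₂_le (fun i x => min (a i x) (b i x)) ⟨fun i => ⟨(ha1 i).min' (hb1 i), (hab i).2⟩,
      lpTendsto_of hΩ hp (hle _ fun i x => ?_)⟩
    refine (abs_min_sub_min_le_max _ _ _ _).trans ?_
    exact max_le_add_of_nonneg (abs_nonneg _) (abs_nonneg _)
  refine (add_le_add h1 h2).trans ((liminf_add_liminf_le _ _).trans ?_)
  refine liminf_le_of_frequently_le' (Frequently.of_forall fun i => ?_)
  rw [grad_max_min hΩ hpm (ha1 i) (hb1 i)]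
  refine (add_le_add (ha5 i) (hb5 i)).trans (le_of_eq ?_)
  rw [add_add_add_comm, ENNReal.add_halves]

/-- Lower semicontinuity of the relaxed modular. -/
lemma bv_le_liminf {n : ℕ} {p : Eu n → ℝ} {Ω : Set (Eu n)} (hΩ : IsOpen Ω)
    (hpm : Measurable p) {M : ℝ} (hp : ∀ x ∈ Ω, 1 ≤ p x ∧ p x ≤ M) {u : Eu n → ℝ}
    {v : ℕ → Eu n → ℝ} (hv : ∀ i, MemLpVar p Ω (v i))
    (h : Tendsto (fun i => vModular p Ω (fun x => v i x - u x)) atTop (𝓝 0)) :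
    bvModular p Ω u ≤ liminf (fun i => bvModular p Ω (v i)) atTop := by
  refine le_of_forall_gt_imp_ge_of_dense fun d hd => bv_le_of_app hΩ hp fun ε hε => ?_
  have hfreq := frequently_lt_of_liminf_lt (by isBoundedDefault) hd
  obtain ⟨η, hη, hη2⟩ : ∃ η : ℝ≥0∞, 0 < η ∧ ENNReal.ofReal (2 ^ M) * (η + η) < ε := by
    have hC : Tendsto (fun k : ℕ => ENNReal.ofReal (2 ^ M) *
        (((k : ℝ≥0∞) + 1)⁻¹ + ((k : ℝ≥0∞) + 1)⁻¹)) atTop (𝓝 0) := by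
      have := ENNReal.Tendsto.const_mul (a := ENNReal.ofReal (2 ^ M))
        (tendsto_inv_succ.add tendsto_inv_succ) (Or.inr ENNReal.ofReal_ne_top)
      simpa using this
    obtain ⟨k, hk⟩ := ((tendsto_order.1 hC).2 ε hε).exists
    exact ⟨_, by simp, hk⟩
  obtain ⟨i, hi1, hi2⟩ := (hfreq.and_eventually ((tendsto_order.1 h).2 η hη)).exists
  obtain ⟨w, hw1, hw2, hw3, hw4, hw5⟩ := appBV_of_lt hΩ hpm hp (hv i) hi1 η hη
  refine ⟨w, hw1, hw2, hw3, ?_, hw5⟩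
  refine (vMod_add_le (f := fun x => w x - v i x) (g := fun x => v i x - u x) hΩ hpm hp
    (hw2.sub (hv i).1) (fun x _ => abs_sub_le _ _ _)).trans_lt (lt_of_le_of_lt ?_ hη2)
  gcongr

/-! ### Capacity -/

lemma bvCapacity_mono {n : ℕ} (p : Eu n → ℝ) (Ω : Set (Eu n)) {A B : Set (Eu n)} (h : A ⊆ B) :
    bvCapacity p Ω A ≤ bvCapacity p Ω B := by
  refine le_iInf₂ fun u hu => iInf₂_le u ?_
  obtain ⟨h1, h2, U, hU, hBU, hU1⟩ := hu
  exact ⟨h1, h2, U, hU, h.trans hBU, hU1⟩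

/-- One inductive step. -/
lemma cap_step {n : ℕ} {p : Eu n → ℝ} {Ω : Set (Eu n)} (hΩ : IsOpen Ω)
    (hpm : Measurable p) {M : ℝ} (hp : ∀ x ∈ Ω, 1 ≤ p x ∧ p x ≤ M) {A B : Set (Eu n)}
    (hAB : A ⊆ B) {u v : Eu n → ℝ} (hv : v ∈ admissibleBV p Ω A) (hu : u ∈ admissibleBV p Ω B) :
    (fun x => max (v x) (u x)) ∈ admissibleBV p Ω B ∧
    bvCapacity p Ω A + (vModular p Ω (fun x => max (v x) (u x)) +
        bvModular p Ω (fun x => max (v x) (u x))) ≤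
      (vModular p Ω v + bvModular p Ω v) + (vModular p Ω u + bvModular p Ω u) := by
  obtain ⟨⟨v1, v2⟩, v3, V, hV, hAV, hV1⟩ := hv
  obtain ⟨⟨u1, u2⟩, u3, U, hU, hBU, hU1⟩ := hu
  have hmm := memLp_max hΩ hpm hp v1 u1
  have hbv := bv_max_min hΩ hpm hp v1 u1
  have hmod := vMod_max_min (Ω := Ω) hpm v1.1 u1.1
  have hfin : bvModular p Ω v + bvModular p Ω u < ⊤ := ENNReal.add_lt_top.2 ⟨v2, u2⟩
  have hfin2 := ENNReal.add_lt_top.1 (hbv.trans_lt hfin)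
  constructor
  · refine ⟨⟨hmm.1, hfin2.1⟩, fun x hx => ⟨le_max_of_le_left (v3 x hx).1,
      max_le (v3 x hx).2 (u3 x hx).2⟩, U, hU, hBU, fun x hx => ?_⟩
    beta_reduce
    rw [hU1 x hx]
    exact max_eq_right (v3 x hx.2).2
  · have hmin : (fun x => min (v x) (u x)) ∈ admissibleBV p Ω A := by
      refine ⟨⟨hmm.2, hfin2.2⟩, fun x hx => ⟨le_min (v3 x hx).1 (u3 x hx).1,
        min_le_of_left_le (v3 x hx).2⟩, V ∩ U, hV.inter hU,
        subset_inter hAV (hAB.trans hBU), fun x hx => ?_⟩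
      beta_reduce
      rw [hU1 x ⟨hx.1.2, hx.2⟩, hV1 x ⟨hx.1.1, hx.2⟩, min_self]
    have hc : bvCapacity p Ω A ≤ vModular p Ω (fun x => min (v x) (u x)) +
        bvModular p Ω (fun x => min (v x) (u x)) := iInf₂_le _ hmin
    calc _ ≤ (vModular p Ω (fun x => min (v x) (u x)) + bvModular p Ω (fun x => min (v x) (u x)))
          + (vModular p Ω (fun x => max (v x) (u x)) +
            bvModular p Ω (fun x => max (v x) (u x))) := by gcongr
      _ = (vModular p Ω (fun x => max (v x) (u x)) + vModular p Ω (fun x => min (v x) (u x))) +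
          (bvModular p Ω (fun x => max (v x) (u x)) +
            bvModular p Ω (fun x => min (v x) (u x))) := by ring
      _ ≤ (vModular p Ω v + vModular p Ω u) + (bvModular p Ω v + bvModular p Ω u) := by
        rw [hmod]; gcongr
      _ = _ := by ring

/-- Running maximum. -/
def runMax {n : ℕ} (u : ℕ → Eu n → ℝ) : ℕ → Eu n → ℝ
  | 0 => u 0
  | k + 1 => fun x => max (runMax u k x) (u (k + 1) x)

lemma cap_union_le {n : ℕ} {p : Eu n → ℝ} {Ω : Set (Eu n)} (hΩ : IsOpen Ω)
    (hpm : Measurable p) {M : ℝ} (hp : ∀ x ∈ Ω, 1 ≤ p x ∧ p x ≤ M)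
    (E : ℕ → Set (Eu n)) (hmono : Monotone E) :
    bvCapacity p Ω (⋃ i, E i) ≤ ⨆ i, bvCapacity p Ω (E i) := by
  refine ENNReal.le_of_forall_pos_le_add fun ε hε hfin => ?_
  set L := ⨆ i, bvCapacity p Ω (E i) with hL
  have hCfin : ∀ i, bvCapacity p Ω (E i) ≠ ⊤ := fun i => ((le_iSup _ i).trans_lt hfin).ne
  obtain ⟨δ, hδ0, hδ⟩ := ENNReal.exists_pos_sum_of_countable' (ε := (ε : ℝ≥0∞))
    (by simpa using hε.ne') ℕ
  have hex : ∀ i, ∃ u ∈ admissibleBV p Ω (E i),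
      vModular p Ω u + bvModular p Ω u < bvCapacity p Ω (E i) + δ i := by
    intro i
    have := ENNReal.lt_add_right (hCfin i) (hδ0 i).ne'
    conv_lhs at this => unfold bvCapacity
    simpa only [iInf_lt_iff, exists_prop] using this
  choose u hu hulo using hex
  set v := runMax u with hvdef
  have hind : ∀ i, v i ∈ admissibleBV p Ω (E i) ∧ vModular p Ω (v i) + bvModular p Ω (v i) ≤
      bvCapacity p Ω (E i) + ∑ j ∈ Finset.range (i + 1), δ j := by
    intro i
    induction i with
    | zero => exact ⟨hu 0, by
        rw [zero_add, Finset.sum_range_one]; exact (hulo 0).le⟩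
    | succ i ih =>
      obtain ⟨h1, h2⟩ := cap_step hΩ hpm hp (hmono (Nat.le_succ i)) ih.1 (hu (i + 1))
      refine ⟨h1, ?_⟩
      refine (ENNReal.add_le_add_iff_left (hCfin i)).1 (h2.trans ?_)
      refine (add_le_add ih.2 (hulo (i + 1)).le).trans (le_of_eq ?_)
      rw [Finset.sum_range_succ _ (i + 1)]
      ring
  have hbound : ∀ i, vModular p Ω (v i) + bvModular p Ω (v i) ≤ L + ε := fun i =>
    (hind i).2.trans (add_le_add (le_iSup (fun i => bvCapacity p Ω (E i)) i)
      ((ENNReal.sum_le_tsum _).trans hδ.le))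
  have hLtop : L + (ε : ℝ≥0∞) < ⊤ := ENNReal.add_lt_top.2 ⟨hfin, ENNReal.coe_lt_top⟩
  have hvm : ∀ x, Monotone fun i => v i x := fun x =>
    monotone_nat_of_le_succ fun i => le_max_left _ _
  have huv : ∀ i x, u i x ≤ v i x := by
    intro i x
    cases i with
    | zero => exact le_rfl
    | succ i => exact le_max_right _ _
  set w : Eu n → ℝ := fun x => ⨆ i, v i x with hw
  have hwmeas : Measurable w := Measurable.iSup fun i => (hind i).1.1.1.1
  have hbdd : ∀ x ∈ Ω, BddAbove (range fun i => v i x) := fun x hx =>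
    ⟨1, by rintro _ ⟨i, rfl⟩; exact ((hind i).1.2.1 x hx).2⟩
  have hlim : ∀ x ∈ Ω, Tendsto (fun i => v i x) atTop (𝓝 (w x)) := fun x hx =>
    tendsto_atTop_ciSup (hvm x) (hbdd x hx)
  have hvw : ∀ i, ∀ x ∈ Ω, v i x ≤ w x := fun i x hx => le_ciSup (hbdd x hx) i
  have hw1 : ∀ x ∈ Ω, w x ≤ 1 := fun x hx => ciSup_le fun i => ((hind i).1.2.1 x hx).2
  have hw0 : ∀ x ∈ Ω, 0 ≤ w x := fun x hx => ((hind 0).1.2.1 x hx).1.trans (hvw 0 x hx)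
  -- Fatou
  have hfatou : vModular p Ω w ≤ liminf (fun i => vModular p Ω (v i)) atTop := by
    refine le_trans (le_of_eq ?_)
      (lintegral_liminf_le fun i => vMod_meas hpm (hind i).1.1.1.1)
    refine setLIntegral_congr_fun hΩ.measurableSet fun x hx => ?_
    refine (Tendsto.liminf_eq ?_).symm
    refine (ENNReal.continuous_ofReal.tendsto _).comp ?_
    exact (hlim x hx).abs.rpow_const (Or.inr (by linarith [(hp x hx).1]))
  have hwfin : vModular p Ω w < ⊤ := by
    refine (hfatou.trans (liminf_le_of_frequently_le'
      (Frequently.of_forall fun i => ?_))).trans_lt hLtop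
    exact le_self_add.trans (hbound i)
  have hwLp : MemLpVar p Ω w := (memLpVar_iff hΩ hp).2 ⟨hwmeas, hwfin⟩
  have hconv : Tendsto (fun i => vModular p Ω (fun x => v i x - w x)) atTop (𝓝 0) := by
    have := tendsto_lintegral_of_dominated_convergence (μ := volume.restrict Ω)
      (F := fun i x => ENNReal.ofReal (|v i x - w x| ^ p x)) (f := fun _ => 0)
      (fun x => ENNReal.ofReal (|w x| ^ p x))
      (fun i => vMod_meas hpm ((hind i).1.1.1.1.sub hwmeas))
      (fun i => (ae_restrict_iff' hΩ.measurableSet).2 (Eventually.of_forall fun x hx => ?_))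
      hwfin.ne
      ((ae_restrict_iff' hΩ.measurableSet).2 (Eventually.of_forall fun x hx => ?_))
    · simpa [vModular] using this
    · apply ENNReal.ofReal_le_ofReal
      refine Real.rpow_le_rpow (abs_nonneg _) ?_ (by linarith [(hp x hx).1])
      have a := hvw i x hx
      have b := ((hind i).1.2.1 x hx).1
      rw [abs_of_nonneg (hw0 x hx), abs_le]
      constructor <;> linarith
    · have hpx : 0 < p x := by linarith [(hp x hx).1]
      have h1 : Tendsto (fun i => |v i x - w x| ^ p x) atTop (𝓝 (|w x - w x| ^ p x)) :=
        ((hlim x hx).sub_const _).abs.rpow_const (Or.inr hpx.le)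
      have h2 := (ENNReal.continuous_ofReal.tendsto _).comp h1
      simpa [Real.zero_rpow hpx.ne', Function.comp_def] using h2
  have hbvw := bv_le_liminf hΩ hpm hp (fun i => (hind i).1.1.1) hconv
  have htot : vModular p Ω w + bvModular p Ω w ≤ L + ε := by
    refine (add_le_add hfatou hbvw).trans ((liminf_add_liminf_le _ _).trans ?_)
    exact liminf_le_of_frequently_le' (Frequently.of_forall hbound)
  refine (iInf₂_le w ?_).trans htot
  choose U hU hEU hU1 using fun i => (hu i).2.2
  refine ⟨⟨hwLp, (le_add_self.trans htot).trans_lt hLtop⟩, fun x hx => ⟨hw0 x hx, hw1 x hx⟩,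
    ⋃ i, U i, isOpen_iUnion hU, iUnion_mono hEU, ?_⟩
  rintro x ⟨hxU, hx⟩
  obtain ⟨i, hi⟩ := mem_iUnion.1 hxU
  refine le_antisymm (hw1 x hx) ?_
  rw [← hU1 i x ⟨hi, hx⟩]
  exact (huv i x).trans (hvw i x hx)

/-- the mixed capacity of an increasing union of sets is the
limit of the capacities. -/
theorem bvCapacity_increasing_union
    {n : ℕ} (p : Eu n → ℝ) (Ω : Set (Eu n)) (hΩ : IsOpen Ω)
    (hpm : Measurable p) (hp1 : ∀ x ∈ Ω, 1 ≤ p x) (hpb : ∃ M : ℝ, ∀ x ∈ Ω, p x ≤ M)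
    (E : ℕ → Set (Eu n)) (hmono : Monotone E) (hsub : ∀ i, E i ⊆ Ω) :
    Tendsto (fun i => bvCapacity p Ω (E i)) atTop
      (𝓝 (bvCapacity p Ω (⋃ i, E i))) := by
  obtain ⟨M, hM⟩ := hpb
  have hp : ∀ x ∈ Ω, 1 ≤ p x ∧ p x ≤ M := fun x hx => ⟨hp1 x hx, hM x hx⟩
  have h1 : bvCapacity p Ω (⋃ i, E i) = ⨆ i, bvCapacity p Ω (E i) :=
    le_antisymm (cap_union_le hΩ hpm hp E hmono)
      (iSup_le fun i => bvCapacity_mono p Ω (subset_iUnion E i))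
  rw [h1]
  exact tendsto_atTop_iSup fun i j hij => bvCapacity_mono p Ω (hmono hij)
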